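/- arXiv:math/0101070 — 2 statements merged into one kernel-verified Lean document; each statement's English description precedes it below -/
import Mathlib

section
/- Let T > 0 and let f : [0,∞) → [0,∞) be a concave, strictly increasing function such that: (i) C·f(x) ≥ f(C·x) for every C > 1 and x ≥ 0; (ii) f(0) = 0 and there exists x with f(x) > 1; (iii) for every n ≥ 1, the function x ↦ x·f(n/x) is concave on the interval (0, n/T]. Then for the simple random walk on ℤ² there exist K > 0 and N such that for all n ≥ N, E[ Σ_{z ∈ ℤ²} f(b_z^(n)) ] ≤ K · f(ln(n)) · n / ln(n). -/
/-!
The simple random walk on `ℤ²`.  A path of length `n` is a function `Fin n → Fin 4`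
choosing at each time one of the four unit steps, each path having probability `4⁻ⁿ`.
-/

/-- The four unit steps of the simple random walk on `ℤ²`. -/
def stepVec : Fin 4 → ℤ × ℤ := ![(1, 0), (-1, 0), (0, 1), (0, -1)]

/-- The position of the walk after `m` steps, along the path `ω`. -/
def pathPos {n : ℕ} (ω : Fin n → Fin 4) (m : ℕ) : ℤ × ℤ :=
  ∑ i ∈ Finset.univ.filter (fun i : Fin n => (i : ℕ) < m), stepVec (ω i)

/-- The local time `b_z⁽ⁿ⁾`: the number of visits to `z` up to time `n`. -/
def localTime {n : ℕ} (ω : Fin n → Fin 4) (z : ℤ × ℤ) : ℕ :=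
  ((Finset.range (n + 1)).filter (fun m => pathPos ω m = z)).card

/-- Expectation of a functional of the simple random walk path of length `n`
(uniform measure on the `4 ^ n` paths). -/
noncomputable def expectSRW (n : ℕ) (g : (Fin n → Fin 4) → ℝ) : ℝ :=
  (∑ ω : Fin n → Fin 4, g ω) / 4 ^ n

/-- The path `ω` visits at time `m` a site it has not visited before. -/
def IsNewAt {n : ℕ} (ω : Fin n → Fin 4) (m : ℕ) : Prop :=
  ∀ j < m, pathPos ω j ≠ pathPos ω m

open Classical in
/-- The number of paths of length `n` whose endpoint is a new site. -/
noncomputable def numNew (n : ℕ) : ℕ :=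
  (Finset.univ.filter (fun ω : Fin n → Fin 4 => IsNewAt ω n)).card

/-- The number of closed paths of length `n`. -/
def numLoops (n : ℕ) : ℕ :=
  (Finset.univ.filter (fun ω : Fin n → Fin 4 => pathPos ω n = 0)).card

/-- The set of sites visited by the path `ω`. -/
def visited {n : ℕ} (ω : Fin n → Fin 4) : Finset (ℤ × ℤ) :=
  (Finset.range (n + 1)).image (pathPos ω)

lemma pathPos_castAdd {m k : ℕ} (ω : Fin (m + k) → Fin 4) {j : ℕ} (hj : j ≤ m) :
    pathPos ω j = pathPos (fun i => ω (Fin.castAdd k i)) j := by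
  unfold pathPos
  rw [Finset.sum_filter, Finset.sum_filter, Fin.sum_univ_add]
  simp only [Fin.val_castAdd, Fin.val_natAdd, add_eq_left]
  refine Finset.sum_eq_zero fun i _ => if_neg ?_
  omega

lemma pathPos_add {m k : ℕ} (ω : Fin (m + k) → Fin 4) :
    pathPos ω (m + k) = pathPos ω m + pathPos (fun i => ω (Fin.natAdd m i)) k := by
  rw [pathPos_castAdd ω le_rfl]
  unfold pathPos
  rw [Finset.sum_filter, Finset.sum_filter, Finset.sum_filter, Fin.sum_univ_add]
  congr 1
  · refine Finset.sum_congr rfl fun i _ => ?_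
    have := i.isLt
    rw [if_pos (by simp; omega), if_pos this]
  · refine Finset.sum_congr rfl fun i _ => ?_
    have := i.isLt
    rw [if_pos (by simp), if_pos this]

lemma isNewAt_castAdd {m k : ℕ} (ω : Fin (m + k) → Fin 4) :
    IsNewAt ω m ↔ IsNewAt (fun i => ω (Fin.castAdd k i)) m := by
  unfold IsNewAt
  rw [pathPos_castAdd ω le_rfl]
  refine forall₂_congr fun j hj => ?_
  rw [pathPos_castAdd ω hj.le]

open Classical in
lemma card_filter_append {α : Type*} [Fintype α] (m k : ℕ) (A : (Fin m → α) → Prop)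
    (B : (Fin k → α) → Prop) :
    (Finset.univ.filter (fun ω : Fin (m + k) → α =>
      A (fun i => ω (Fin.castAdd k i)) ∧ B (fun i => ω (Fin.natAdd m i)))).card
      = (Finset.univ.filter A).card * (Finset.univ.filter B).card := by
  rw [← Finset.card_product]
  refine Finset.card_bij'
    (fun ω _ => (fun i => ω (Fin.castAdd k i), fun i => ω (Fin.natAdd m i)))
    (fun p _ => Fin.append p.1 p.2) ?_ ?_ ?_ ?_
  · intro ω h
    simpa using h
  · intro p h
    simpa using h
  · intro ω _
    exact Fin.append_castAdd_natAdd
  · intro p _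
    simp

open Classical in
lemma numNew_mul_numLoops (m k : ℕ) :
    numNew m * numLoops k = (Finset.univ.filter (fun ω : Fin (m + k) → Fin 4 =>
      IsNewAt ω m ∧ pathPos ω (m + k) = pathPos ω m)).card := by
  have h := card_filter_append (α := Fin 4) m k (fun ω => IsNewAt ω m)
    (fun ω => pathPos ω k = 0)
  unfold numNew numLoops
  simp only [isNewAt_castAdd, pathPos_add, add_eq_left]
  convert h.symm

open Classical in
lemma numNew_mul_four_pow (m k : ℕ) :
    numNew m * 4 ^ k
      = (Finset.univ.filter (fun ω : Fin (m + k) → Fin 4 => IsNewAt ω m)).card := by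
  have h := card_filter_append (α := Fin 4) m k (fun ω => IsNewAt ω m) (fun _ => True)
  unfold numNew
  simpa [isNewAt_castAdd] using h.symm

/-- The first-visit decomposition of the endpoint of a path of length `t`. -/
lemma sum_numNew_mul_numLoops_le (t : ℕ) :
    ∑ p ∈ Finset.HasAntidiagonal.antidiagonal t, numNew p.1 * numLoops p.2 ≤ 4 ^ t := by
  classical
  have h : ∀ p ∈ Finset.HasAntidiagonal.antidiagonal t, numNew p.1 * numLoops p.2
      = (Finset.univ.filter (fun ω : Fin t → Fin 4 =>
          IsNewAt ω p.1 ∧ pathPos ω t = pathPos ω p.1)).card := by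
    rintro ⟨m, k⟩ hp
    obtain rfl : m + k = t := by simpa using hp
    exact numNew_mul_numLoops m k
  rw [Finset.sum_congr rfl h, ← Finset.card_biUnion]
  · refine (Finset.card_le_univ _).trans ?_
    simp
  · intro p hp q hq hpq
    rw [Function.onFun, Finset.disjoint_left]
    intro ω h1 h2
    simp only [Finset.mem_filter, Finset.mem_univ, true_and] at h1 h2
    simp only [SetLike.mem_coe, Finset.HasAntidiagonal.mem_antidiagonal] at hp hq
    rcases lt_trichotomy p.1 q.1 with h | h | h
    · exact h2.1 _ h (h1.2.symm.trans h2.2)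
    · exact hpq (Prod.ext h (by omega))
    · exact h1.1 _ h (h2.2.symm.trans h1.2)

open Classical in
lemma card_visited_le {n : ℕ} (ω : Fin n → Fin 4) :
    (visited ω).card ≤ ((Finset.range (n + 1)).filter (fun m => IsNewAt ω m)).card := by
  refine le_trans (Finset.card_le_card ?_) (Finset.card_image_le (f := pathPos ω))
  intro z hz
  have hz' : ∃ m, m < n + 1 ∧ pathPos ω m = z := by simpa [visited] using hz
  have hs := Nat.find_spec hz'
  refine Finset.mem_image.2 ⟨Nat.find hz', ?_, hs.2⟩
  refine Finset.mem_filter.2 ⟨Finset.mem_range.2 hs.1, fun j hj hj' => ?_⟩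
  exact Nat.find_min hz' hj ⟨hj.trans hs.1, hj'.trans hs.2⟩

lemma sum_card_visited_le (n : ℕ) :
    ∑ ω : Fin n → Fin 4, (visited ω).card
      ≤ ∑ m ∈ Finset.range (n + 1), numNew m * 4 ^ (n - m) := by
  classical
  refine (Finset.sum_le_sum fun ω _ => card_visited_le ω).trans (le_of_eq ?_)
  simp only [Finset.card_filter]
  rw [Finset.sum_comm]
  refine Finset.sum_congr rfl fun m hm => ?_
  obtain ⟨k, rfl⟩ := Nat.exists_eq_add_of_le (Nat.lt_succ_iff.1 (Finset.mem_range.1 hm))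
  rw [Nat.add_sub_cancel_left, numNew_mul_four_pow, Finset.card_filter]

lemma expectSRW_card_visited_le (n : ℕ) :
    expectSRW n (fun ω => ((visited ω).card : ℝ))
      ≤ ∑ m ∈ Finset.range (n + 1), (numNew m : ℝ) / 4 ^ m := by
  unfold expectSRW
  rw [div_le_iff₀ (by positivity), Finset.sum_mul]
  have h : ((∑ ω : Fin n → Fin 4, (visited ω).card : ℕ) : ℝ)
      ≤ ((∑ m ∈ Finset.range (n + 1), numNew m * 4 ^ (n - m) : ℕ) : ℝ) :=
    Nat.cast_le.2 (sum_card_visited_le n)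
  push_cast at h
  refine h.trans (le_of_eq (Finset.sum_congr rfl fun m hm => ?_))
  have hm' : m ≤ n := Nat.lt_succ_iff.1 (Finset.mem_range.1 hm)
  rw [← Nat.add_sub_cancel' hm', pow_add, Nat.add_sub_cancel_left]
  field_simp

lemma sum_mul_sum_le (n : ℕ) :
    (∑ m ∈ Finset.range (n + 1), (numNew m : ℝ) / 4 ^ m) *
      (∑ k ∈ Finset.range (n + 1), (numLoops k : ℝ) / 4 ^ k) ≤ 2 * n + 1 := by
  have h1 : ∀ t : ℕ, ∑ p ∈ Finset.HasAntidiagonal.antidiagonal t,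
      ((numNew p.1 : ℝ) / 4 ^ p.1 * ((numLoops p.2 : ℝ) / 4 ^ p.2)) ≤ 1 := by
    intro t
    have h : ((∑ p ∈ Finset.HasAntidiagonal.antidiagonal t, numNew p.1 * numLoops p.2 : ℕ) : ℝ)
        ≤ ((4 ^ t : ℕ) : ℝ) := Nat.cast_le.2 (sum_numNew_mul_numLoops_le t)
    push_cast at h
    rw [← div_le_one (by positivity), Finset.sum_div] at h
    refine le_trans (le_of_eq (Finset.sum_congr rfl fun p hp => ?_)) h
    rw [← Finset.HasAntidiagonal.mem_antidiagonal.1 hp, pow_add, div_mul_div_comm]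
  have h2 : ∑ t ∈ Finset.range (2 * n + 1), ∑ p ∈ Finset.HasAntidiagonal.antidiagonal t,
      ((numNew p.1 : ℝ) / 4 ^ p.1 * ((numLoops p.2 : ℝ) / 4 ^ p.2)) ≤ 2 * n + 1 := by
    refine (Finset.sum_le_sum fun t _ => h1 t).trans (le_of_eq ?_)
    simp
  refine le_trans ?_ h2
  rw [Finset.sum_mul_sum, ← Finset.sum_product', ← Finset.sum_biUnion]
  · refine Finset.sum_le_sum_of_subset_of_nonneg ?_ fun p _ _ => by positivity
    intro p hp
    simp only [Finset.mem_product, Finset.mem_range, Finset.mem_biUnion,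
      Finset.HasAntidiagonal.mem_antidiagonal, exists_eq_right'] at hp ⊢
    omega
  · intro s _ t _ hst
    rw [Function.onFun, Finset.disjoint_left]
    intro p hs ht
    exact hst ((Finset.HasAntidiagonal.mem_antidiagonal.1 hs).symm.trans (Finset.HasAntidiagonal.mem_antidiagonal.1 ht))

/-- The path whose `i`-th step has coordinate sum `1` or `-1` according to whether `i ∈ s`, and
coordinate difference `1` or `-1` according to whether `i ∈ t`. -/
def pathOfSets {n : ℕ} (s t : Finset (Fin n)) (i : Fin n) : Fin 4 :=
  if i ∈ s then (if i ∈ t then 0 else 2) else (if i ∈ t then 3 else 1)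

lemma pathOfSets_injective {n : ℕ} :
    Function.Injective (fun p : Finset (Fin n) × Finset (Fin n) => pathOfSets p.1 p.2) := by
  rintro ⟨s, t⟩ ⟨s', t'⟩ h
  have h' : ∀ i, (i ∈ s ↔ i ∈ s') ∧ (i ∈ t ↔ i ∈ t') := by
    intro i
    have hi := congrFun h i
    simp only [pathOfSets] at hi
    by_cases h1 : i ∈ s <;> by_cases h2 : i ∈ t <;> by_cases h3 : i ∈ s' <;>
      by_cases h4 : i ∈ t' <;> simp [h1, h2, h3, h4] at hi ⊢
  exact Prod.ext (Finset.ext fun i => (h' i).1) (Finset.ext fun i => (h' i).2)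

lemma sum_ite_one_neg_one {k : ℕ} {s : Finset (Fin (2 * k))} (hs : s.card = k) :
    ∑ i : Fin (2 * k), (if i ∈ s then (1 : ℤ) else -1) = 0 := by
  have h : ∀ i : Fin (2 * k), (if i ∈ s then (1 : ℤ) else -1)
      = 2 * (if i ∈ s then 1 else 0) - 1 := by
    intro i
    split_ifs <;> norm_num
  simp only [h, Finset.sum_sub_distrib, ← Finset.mul_sum]
  simp [hs]

lemma pathPos_pathOfSets {k : ℕ} {s t : Finset (Fin (2 * k))} (hs : s.card = k)
    (ht : t.card = k) : pathPos (pathOfSets s t) (2 * k) = 0 := by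
  have h0 : pathPos (pathOfSets s t) (2 * k) = ∑ i, stepVec (pathOfSets s t i) := by
    unfold pathPos
    rw [Finset.filter_true_of_mem fun i _ => i.isLt]
  have h1 := sum_ite_one_neg_one hs
  have h2 := sum_ite_one_neg_one ht
  have h3 : (∑ i, stepVec (pathOfSets s t i)).1 + (∑ i, stepVec (pathOfSets s t i)).2 = 0 := by
    rw [Prod.fst_sum, Prod.snd_sum, ← Finset.sum_add_distrib, ← h1]
    refine Finset.sum_congr rfl fun i _ => ?_
    unfold pathOfSets
    split_ifs <;> simp [stepVec]
  have h4 : (∑ i, stepVec (pathOfSets s t i)).1 - (∑ i, stepVec (pathOfSets s t i)).2 = 0 := by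
    rw [Prod.fst_sum, Prod.snd_sum, ← Finset.sum_sub_distrib, ← h2]
    refine Finset.sum_congr rfl fun i _ => ?_
    unfold pathOfSets
    split_ifs <;> simp [stepVec]
  rw [h0]
  exact Prod.ext (by simp only [Prod.fst_zero]; omega) (by simp only [Prod.snd_zero]; omega)

lemma centralBinom_sq_le_numLoops (k : ℕ) : k.centralBinom ^ 2 ≤ numLoops (2 * k) := by
  have hc : ((Finset.univ : Finset (Fin (2 * k))).powersetCard k ×ˢ
      (Finset.univ : Finset (Fin (2 * k))).powersetCard k).card = k.centralBinom ^ 2 := by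
    simp [Nat.centralBinom, sq]
  rw [← hc]
  refine Finset.card_le_card_of_injOn (fun p => pathOfSets p.1 p.2) ?_
    pathOfSets_injective.injOn
  rintro ⟨s, t⟩ hp
  simp only [Finset.coe_product, Set.mem_prod, SetLike.mem_coe,
    Finset.mem_powersetCard_univ] at hp
  simpa using pathPos_pathOfSets hp.1 hp.2

lemma sixteen_pow_le (k : ℕ) : 16 ^ (k + 1) ≤ 4 * (k + 1) * (k + 1).centralBinom ^ 2 := by
  induction k with
  | zero => simp [Nat.centralBinom, Nat.choose]
  | succ k ih =>
    have h := Nat.succ_mul_centralBinom_succ (k + 1)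
    set a := (k + 1).centralBinom
    set b := (k + 1 + 1).centralBinom
    have h2 : (k + 2) ^ 2 * b ^ 2 = 4 * (2 * k + 3) ^ 2 * a ^ 2 := by
      have : (k + 2) * b = 2 * (2 * k + 3) * a := by linarith
      calc (k + 2) ^ 2 * b ^ 2 = ((k + 2) * b) ^ 2 := by ring
        _ = _ := by rw [this]; ring
    have h3 : (k + 1) * (k + 2) * 16 ^ (k + 2)
        ≤ (k + 1) * (k + 2) * (4 * (k + 2) * b ^ 2) := by
      calc (k + 1) * (k + 2) * 16 ^ (k + 2)
          = 16 * ((k + 1) * (k + 2)) * 16 ^ (k + 1) := by ring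
        _ ≤ 16 * ((k + 1) * (k + 2)) * (4 * (k + 1) * a ^ 2) := by gcongr
        _ = 16 * (k + 1) * a ^ 2 * (4 * ((k + 1) * (k + 2))) := by ring
        _ ≤ 16 * (k + 1) * a ^ 2 * (2 * k + 3) ^ 2 := by
            refine Nat.mul_le_mul_left _ ?_
            nlinarith
        _ = (k + 1) * 4 * (4 * (2 * k + 3) ^ 2 * a ^ 2) := by ring
        _ = (k + 1) * (k + 2) * (4 * (k + 2) * b ^ 2) := by rw [← h2]; ring
    exact Nat.le_of_mul_le_mul_left h3 (by positivity)

lemma inv_le_numLoops_div (k : ℕ) :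
    1 / 4 * ((k : ℝ) + 1)⁻¹ ≤ (numLoops (2 * (k + 1)) : ℝ) / 4 ^ (2 * (k + 1)) := by
  have h : ((16 ^ (k + 1) : ℕ) : ℝ) ≤ ((4 * (k + 1) * numLoops (2 * (k + 1)) : ℕ) : ℝ) :=
    Nat.cast_le.2 ((sixteen_pow_le k).trans
      (Nat.mul_le_mul_left _ (centralBinom_sq_le_numLoops (k + 1))))
  push_cast at h
  rw [pow_mul, le_div_iff₀ (by positivity)]
  norm_num
  calc 1 / 4 * ((k : ℝ) + 1)⁻¹ * 16 ^ (k + 1)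
      ≤ 1 / 4 * ((k : ℝ) + 1)⁻¹ * (4 * (k + 1) * numLoops (2 * (k + 1))) := by gcongr
    _ = numLoops (2 * (k + 1)) := by field_simp

/-- The Green function of the planar walk grows at least logarithmically. -/
lemma log_le_sum_numLoops (n : ℕ) (hn : 1 ≤ n) :
    Real.log n / 8 ≤ ∑ k ∈ Finset.range (n + 1), (numLoops k : ℝ) / 4 ^ k := by
  have h1 : ∑ j ∈ Finset.range (n / 2), (numLoops (2 * (j + 1)) : ℝ) / 4 ^ (2 * (j + 1))
      ≤ ∑ k ∈ Finset.range (n + 1), (numLoops k : ℝ) / 4 ^ k := by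
    rw [← Finset.sum_image (s := Finset.range (n / 2)) (g := fun j => 2 * (j + 1))
      (f := fun k => (numLoops k : ℝ) / 4 ^ k) (by intro a _ b _ h; simpa using h)]
    refine Finset.sum_le_sum_of_subset_of_nonneg ?_ fun p _ _ => by positivity
    intro k hk
    simp only [Finset.mem_image, Finset.mem_range] at hk ⊢
    omega
  have h2 : 1 / 4 * ((harmonic (n / 2) : ℚ) : ℝ)
      ≤ ∑ j ∈ Finset.range (n / 2), (numLoops (2 * (j + 1)) : ℝ) / 4 ^ (2 * (j + 1)) := by
    unfold harmonic
    push_cast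
    rw [Finset.mul_sum]
    exact Finset.sum_le_sum fun j _ => inv_le_numLoops_div j
  have h3 := log_add_one_le_harmonic (n / 2)
  have h4 : Real.log n ≤ 2 * Real.log ((n / 2 : ℕ) + 1 : ℝ) := by
    have h5 : n ≤ (n / 2 + 1) ^ 2 := by
      have : n ≤ 2 * (n / 2) + 1 := by omega
      nlinarith
    have h6 : (n : ℝ) ≤ ((n / 2 : ℕ) + 1 : ℝ) ^ 2 := by exact_mod_cast h5
    have h7 : (0 : ℝ) < n := by exact_mod_cast hn
    calc Real.log n ≤ Real.log (((n / 2 : ℕ) + 1 : ℝ) ^ 2) := Real.log_le_log h7 h6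
      _ = _ := by rw [Real.log_pow]; norm_num
  push_cast at h3
  linarith

/-- The expected number of visited sites is `O(n / log n)`. -/
lemma expectSRW_card_visited_le_div_log (n : ℕ) (hn : 2 ≤ n) :
    expectSRW n (fun ω => ((visited ω).card : ℝ)) ≤ 24 * n / Real.log n := by
  have hlog : 0 < Real.log n := Real.log_pos (by exact_mod_cast hn)
  have hn' : (2 : ℝ) ≤ n := by exact_mod_cast hn
  have hnew := sum_mul_sum_le n
  have hloops := log_le_sum_numLoops n (by omega)
  refine (expectSRW_card_visited_le n).trans ?_
  have hpos : 0 ≤ ∑ m ∈ Finset.range (n + 1), (numNew m : ℝ) / 4 ^ m :=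
    Finset.sum_nonneg fun _ _ => by positivity
  rw [le_div_iff₀ hlog]
  have := mul_le_mul_of_nonneg_left hloops hpos
  linarith

lemma localTime_eq_zero {n : ℕ} (ω : Fin n → Fin 4) {z : ℤ × ℤ} (hz : z ∉ visited ω) :
    localTime ω z = 0 := by
  unfold localTime
  rw [Finset.card_eq_zero, Finset.filter_eq_empty_iff]
  exact fun m hm h => hz (Finset.mem_image.2 ⟨m, hm, h⟩)

lemma sum_localTime {n : ℕ} (ω : Fin n → Fin 4) :
    ∑ z ∈ visited ω, localTime ω z = n + 1 := by
  unfold localTime visited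
  rw [← Finset.card_eq_sum_card_image, Finset.card_range]

lemma tsum_localTime_le {f : ℝ → ℝ} (hmono : MonotoneOn f (Set.Ici 0))
    (hhom : ∀ C : ℝ, 1 < C → ∀ x : ℝ, 0 ≤ x → f (C * x) ≤ C * f x) (hf0 : f 0 = 0)
    {a : ℝ} (ha : 0 < a) {n : ℕ} (ω : Fin n → Fin 4) :
    ∑' z : ℤ × ℤ, f (localTime ω z) ≤ f a * ((visited ω).card + (n + 1) / a) := by
  have hfa : 0 ≤ f a := by
    rw [← hf0]
    exact hmono Set.self_mem_Ici ha.le ha.le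
  have hb : ∀ b : ℝ, 0 ≤ b → f b ≤ f a * (1 + b / a) := by
    intro b hb
    have hba : 0 ≤ b / a := by positivity
    rcases le_or_gt b a with h | h
    · have := hmono hb ha.le h
      nlinarith
    · have := hhom (b / a) ((one_lt_div ha).2 h) a ha.le
      rw [div_mul_cancel₀ _ ha.ne'] at this
      nlinarith
  rw [tsum_eq_sum (s := visited ω) fun z hz => by
    rw [localTime_eq_zero ω hz, Nat.cast_zero, hf0]]
  refine (Finset.sum_le_sum fun z _ => hb _ (Nat.cast_nonneg _)).trans (le_of_eq ?_)
  rw [← Finset.mul_sum, Finset.sum_add_distrib, ← Finset.sum_div, ← Nat.cast_sum,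
    sum_localTime]
  simp

/-- Let `T > 0` and let `f : [0,∞) → [0,∞)` be a concave, strictly
increasing function such that: (i) `C·f(x) ≥ f(C·x)` for every `C > 1` and `x ≥ 0`;
(ii) `f(0) = 0` and there exists `x` with `f(x) > 1`; (iii) for every `n ≥ 1` the
function `x ↦ x·f(n/x)` is concave on `(0, n/T]`.  Then for the simple random walk
on `ℤ²` there exist `K > 0` and `N` such that for all `n ≥ N`,
`E[Σ_{z ∈ ℤ²} f(b_z⁽ⁿ⁾)] ≤ K · f(ln n) · n / ln n`. -/
theorem expected_local_time_functional_upper (T : ℝ) (hT : 0 < T) (f : ℝ → ℝ)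
    (hconc : ConcaveOn ℝ (Set.Ici 0) f)
    (hmono : StrictMonoOn f (Set.Ici 0))
    (hnonneg : ∀ x ∈ Set.Ici (0 : ℝ), 0 ≤ f x)
    (hhom : ∀ C : ℝ, 1 < C → ∀ x : ℝ, 0 ≤ x → f (C * x) ≤ C * f x)
    (hf0 : f 0 = 0)
    (hbig : ∃ x : ℝ, 0 ≤ x ∧ 1 < f x)
    (hconc2 : ∀ n : ℝ, 1 ≤ n →
      ConcaveOn ℝ (Set.Ioc 0 (n / T)) (fun x => x * f (n / x))) :
    ∃ K > (0 : ℝ), ∃ N : ℕ, ∀ n : ℕ, N ≤ n →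
      expectSRW n (fun ω => ∑' z : ℤ × ℤ, f (localTime ω z))
        ≤ K * f (Real.log n) * n / Real.log n := by
  refine ⟨26, by norm_num, 2, fun n hn => ?_⟩
  have hlog : 0 < Real.log n := Real.log_pos (by exact_mod_cast hn)
  have hn' : (2 : ℝ) ≤ n := by exact_mod_cast hn
  have hfa : 0 ≤ f (Real.log n) := hnonneg _ hlog.le
  have hR := expectSRW_card_visited_le_div_log n hn
  have hE : expectSRW n (fun ω => ∑' z : ℤ × ℤ, f (localTime ω z))
      ≤ f (Real.log n) *
        (expectSRW n (fun ω => ((visited ω).card : ℝ)) + (n + 1) / Real.log n) := by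
    unfold expectSRW
    rw [div_le_iff₀ (by positivity)]
    refine (Finset.sum_le_sum fun ω _ =>
      tsum_localTime_le hmono.monotoneOn hhom hf0 hlog ω).trans (le_of_eq ?_)
    rw [← Finset.mul_sum, Finset.sum_add_distrib]
    simp
    field_simp
  calc _ ≤ _ := hE
    _ ≤ f (Real.log n) * (24 * n / Real.log n + 2 * n / Real.log n) := by
        gcongr
        linarith
    _ = 26 * f (Real.log n) * n / Real.log n := by ring
end

section
/- Let G be a group with finite symmetric generating set S and word length l, and let μ be a symmetric probability measure on G with finite generating support, supported on S ∪ {e}. Assume the Gaussian upper bound: there exist K₁, K₂ > 0 such that μ^{*n}(x) ≤ K₁ · n^{3/4} · exp(−K₂ · l(x)²/n) for every x ∈ G and n ≥ 1. Then there exists K > 0 such that for all n ≥ 2, L(n) ≤ K · sqrt( n · ( ln(v(n)) + ln(n) ) ). -/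
noncomputable def wordLength {G : Type*} [Group G] (S : Finset G) (g : G) : ℕ :=
  sInf {n | ∃ l : List G, l.length = n ∧ (∀ x ∈ l, x ∈ S) ∧ l.prod = g}

open Classical in
/-- The `n`-fold convolution power `μ^{*n}` of a measure `μ` on the group `G`
(with `μ^{*0} = δ_e`). -/
noncomputable def convPow {G : Type*} [Group G] (μ : G → ℝ) : ℕ → G → ℝ
  | 0 => fun g => if g = 1 then (1 : ℝ) else 0
  | (n + 1) => fun g => ∑' h : G, convPow μ n h * μ (h⁻¹ * g)

/-- The entropy `H n = -Σ_g μ^{*n}(g) ln μ^{*n}(g)` of the random walk with step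
distribution `μ`. -/
noncomputable def entropy {G : Type*} [Group G] (μ : G → ℝ) (n : ℕ) : ℝ :=
  -∑' g : G, convPow μ n g * Real.log (convPow μ n g)

/-- The drift `L n = Σ_g μ^{*n}(g) l(g)` of the random walk with step distribution `μ`,
where `l` is the word length relative to `S`. -/
noncomputable def driftMeas {G : Type*} [Group G] (S : Finset G) (μ : G → ℝ) (n : ℕ) : ℝ :=
  ∑' g : G, convPow μ n g * (wordLength S g : ℝ)

/-- The growth function `v n = #{g : l(g) ≤ n}`. -/
noncomputable def growth {G : Type*} [Group G] (S : Finset G) (n : ℕ) : ℕ :=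
  Set.ncard {g : G | wordLength S g ≤ n}

theorem exists_list_prod_eq {G : Type*} [Group G] {S : Finset G}
    (hS_sym : ∀ x ∈ S, x⁻¹ ∈ S) (hS_gen : Subgroup.closure (S : Set G) = ⊤) (g : G) :
    ∃ l : List G, l.length = wordLength S g ∧ (∀ x ∈ l, x ∈ S) ∧ l.prod = g := by
  refine Nat.sInf_mem (s := {n | ∃ l : List G, l.length = n ∧ (∀ x ∈ l, x ∈ S) ∧ l.prod = g}) ?_
  have hg : g ∈ Subgroup.closure (S : Set G) := hS_gen ▸ Subgroup.mem_top g
  rw [← Subgroup.mem_toSubmonoid, Subgroup.closure_toSubmonoid] at hg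
  obtain ⟨l, hl, rfl⟩ := Submonoid.exists_list_of_mem_closure hg
  exact ⟨l.length, l, rfl, fun x hx => (hl x hx).elim id fun h => inv_inv x ▸ hS_sym _ h, rfl⟩

theorem finite_wordLength_le {G : Type*} [Group G] {S : Finset G}
    (hS_sym : ∀ x ∈ S, x⁻¹ ∈ S) (hS_gen : Subgroup.closure (S : Set G) = ⊤) (n : ℕ) :
    {g : G | wordLength S g ≤ n}.Finite := by
  refine ((List.finite_length_le S n).image fun l => (l.map Subtype.val).prod).subset ?_
  intro g hg
  obtain ⟨l, hlen, hl, rfl⟩ := exists_list_prod_eq hS_sym hS_gen g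
  refine ⟨l.attach.map fun x => ⟨x.1, hl _ x.2⟩, ?_, ?_⟩
  · simpa [hlen] using hg
  · simp [Function.comp_def]

theorem exists_list_of_convPow_ne_zero {G : Type*} [Group G] {S : Finset G} {μ : G → ℝ}
    (hμ_supp : Function.support μ ⊆ (S : Set G) ∪ {1}) (n : ℕ) :
    ∀ g : G, convPow μ n g ≠ 0 →
      ∃ l : List G, l.length ≤ n ∧ (∀ x ∈ l, x ∈ S) ∧ l.prod = g := by
  induction n with
  | zero =>
    intro g hg
    have hg1 : g = 1 := by
      by_contra h
      exact hg (by simp [convPow, h])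
    exact ⟨[], by simp [hg1]⟩
  | succ n ih =>
    intro g hg
    obtain ⟨h, hh⟩ : ∃ h, convPow μ n h * μ (h⁻¹ * g) ≠ 0 := by
      by_contra! hall
      exact hg (by simp [convPow, hall])
    obtain ⟨l, hlen, hl, hprod⟩ := ih h (left_ne_zero_of_mul hh)
    rcases hμ_supp (right_ne_zero_of_mul hh) with hs | hs
    · refine ⟨l ++ [h⁻¹ * g], by simpa using hlen, ?_, by simp [hprod]⟩
      intro x hx
      rcases List.mem_append.1 hx with hx | hx
      · exact hl x hx
      · rw [List.mem_singleton.1 hx]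
        exact hs
    · exact ⟨l, by omega, hl, by rw [hprod]; exact inv_mul_eq_one.1 hs⟩

theorem wordLength_le_of_convPow_ne_zero {G : Type*} [Group G] {S : Finset G} {μ : G → ℝ}
    (hμ_supp : Function.support μ ⊆ (S : Set G) ∪ {1}) {n : ℕ} {g : G}
    (hg : convPow μ n g ≠ 0) : wordLength S g ≤ n := by
  obtain ⟨l, hlen, hl, hprod⟩ := exists_list_of_convPow_ne_zero hμ_supp n g hg
  have hmin : wordLength S g ≤ l.length := Nat.sInf_le ⟨l, rfl, hl, hprod⟩
  exact hmin.trans hlen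

theorem convPow_nonneg {G : Type*} [Group G] {μ : G → ℝ} (hμ_nonneg : ∀ g, 0 ≤ μ g) (n : ℕ) :
    ∀ g : G, 0 ≤ convPow μ n g := by
  induction n with
  | zero => intro g; simp only [convPow]; split_ifs <;> norm_num
  | succ n ih => exact fun g => tsum_nonneg fun h => mul_nonneg (ih h) (hμ_nonneg _)

theorem sum_convPow_le_one {G : Type*} [Group G] {μ : G → ℝ} (hμ_nonneg : ∀ g, 0 ≤ μ g)
    (hμ_total : ∑' g : G, μ g = 1) (n : ℕ)
    (hfin : ∀ m, (Function.support (convPow μ m)).Finite) :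
    ∀ B : Finset G, ∑ g ∈ B, convPow μ n g ≤ 1 := by
  classical
  have hsum : Summable μ := by
    by_contra h
    simp [tsum_eq_zero_of_not_summable h] at hμ_total
  induction n with
  | zero =>
    intro B
    simp only [convPow, Finset.sum_ite_eq']
    split_ifs <;> norm_num
  | succ n ih =>
    intro B
    have hconv (g : G) : convPow μ (n + 1) g =
        ∑ h ∈ (hfin n).toFinset, convPow μ n h * μ (h⁻¹ * g) :=
      tsum_eq_sum fun h hh => by
        rw [Set.Finite.mem_toFinset, Function.notMem_support] at hh
        rw [hh, zero_mul]
    have hshift (h : G) : ∑ g ∈ B, μ (h⁻¹ * g) ≤ 1 := by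
      rw [← hμ_total, ← (Equiv.mulLeft h⁻¹).tsum_eq μ]
      exact ((Equiv.mulLeft h⁻¹).summable_iff.2 hsum).sum_le_tsum B fun g _ => hμ_nonneg _
    calc ∑ g ∈ B, convPow μ (n + 1) g
        = ∑ h ∈ (hfin n).toFinset, convPow μ n h * ∑ g ∈ B, μ (h⁻¹ * g) := by
          simp_rw [hconv, Finset.mul_sum]
          exact Finset.sum_comm
      _ ≤ ∑ h ∈ (hfin n).toFinset, convPow μ n h :=
          Finset.sum_le_sum fun h _ =>
            mul_le_of_le_one_right (convPow_nonneg hμ_nonneg n h) (hshift h)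
      _ ≤ 1 := ih _

/-- Let `G` be a group with finite symmetric generating set `S` and
word length `l`, and let `μ` be a symmetric probability measure on `G` supported on
`S ∪ {e}` with generating support.  Assume the Gaussian upper bound: there are
`K₁, K₂ > 0` with `μ^{*n}(x) ≤ K₁ n^{3/4} exp(-K₂ l(x)²/n)` for all `x` and `n ≥ 1`.
Then there exists `K > 0` such that for all `n ≥ 2`,
`L n ≤ K √(n (ln (v n) + ln n))`. -/
theorem drift_le_sqrt_growth {G : Type*} [Group G] (S : Finset G)
    (hS_sym : ∀ x ∈ S, x⁻¹ ∈ S) (hS_gen : Subgroup.closure (S : Set G) = ⊤)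
    (μ : G → ℝ)
    (hμ_nonneg : ∀ g, 0 ≤ μ g)
    (hμ_total : ∑' g : G, μ g = 1)
    (hμ_symm : ∀ g, μ g⁻¹ = μ g)
    (hμ_supp : Function.support μ ⊆ (S : Set G) ∪ {1})
    (hμ_gen : Subgroup.closure (Function.support μ) = ⊤)
    (K₁ K₂ : ℝ) (hK₁ : 0 < K₁) (hK₂ : 0 < K₂)
    (hGauss : ∀ x : G, ∀ n : ℕ, 1 ≤ n →
      convPow μ n x ≤ K₁ * (n : ℝ) ^ ((3 : ℝ) / 4) *
        Real.exp (-K₂ * (wordLength S x : ℝ) ^ 2 / n)) :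
    ∃ K > (0 : ℝ), ∀ n : ℕ, 2 ≤ n →
      driftMeas S μ n ≤ K * Real.sqrt (n * (Real.log (growth S n) + Real.log n)) := by
  have hball := finite_wordLength_le hS_sym hS_gen
  have hsub (m : ℕ) : Function.support (convPow μ m) ⊆ {g | wordLength S g ≤ m} :=
    fun g hg => wordLength_le_of_convPow_ne_zero hμ_supp hg
  refine ⟨√(3 / K₂) + K₁, by positivity, fun n hn => ?_⟩
  set v := growth S n
  set B := (hball n).toFinset with hB
  have hcard : B.card = v := (Set.ncard_eq_toFinset_card _ (hball n)).symm
  have hone : (1 : G) ∈ B := by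
    have : wordLength S (1 : G) ≤ 0 := Nat.sInf_le ⟨[], by simp⟩
    simp only [hB, Set.Finite.mem_toFinset, Set.mem_ofPred_eq]
    omega
  have hv1 : (1 : ℝ) ≤ v := by
    exact_mod_cast hcard ▸ Finset.card_pos.2 ⟨1, hone⟩
  have hv0 : (0 : ℝ) < v := by linarith
  have hn2 : (2 : ℝ) ≤ n := by exact_mod_cast hn
  have hn0 : (0 : ℝ) < n := by linarith
  have hlogv : 0 ≤ Real.log v := Real.log_nonneg hv1
  have hlogn : 1 / 2 ≤ Real.log n :=
    (by linarith [Real.log_two_gt_d9] : 1 / 2 ≤ Real.log 2).trans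
      (Real.log_le_log (by norm_num) hn2)
  set A := Real.log v + Real.log n with hA
  have hT : 1 ≤ √(n * A) := Real.one_le_sqrt.2 (by nlinarith)
  set r := √(3 / K₂) * √(n * A) with hr
  have hr0 : 0 ≤ r := by positivity
  have hr2 : K₂ * r ^ 2 = 3 * A * n := by
    rw [hr, mul_pow, Real.sq_sqrt (by positivity), Real.sq_sqrt (by nlinarith)]
    field_simp
  have hpoint : ∀ g ∈ B,
      convPow μ n g * wordLength S g ≤ convPow μ n g * r + K₁ / v := by
    intro g hg
    have hp := convPow_nonneg hμ_nonneg n g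
    have hgn : (wordLength S g : ℝ) ≤ n := by
      exact_mod_cast (Set.Finite.mem_toFinset _).1 hg
    rcases le_or_gt (wordLength S g : ℝ) r with hle | hlt
    · exact (mul_le_mul_of_nonneg_left hle hp).trans (le_add_of_nonneg_right (by positivity))
    · have hexp : Real.exp (-K₂ * (wordLength S g : ℝ) ^ 2 / n) ≤ 1 / (v * (n : ℝ) ^ 2) := by
        calc Real.exp (-K₂ * (wordLength S g : ℝ) ^ 2 / n)
            ≤ Real.exp (-(Real.log v + 2 * Real.log n)) := by
              rw [Real.exp_le_exp, div_le_iff₀ hn0]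
              have h1 : K₂ * r ^ 2 ≤ K₂ * (wordLength S g : ℝ) ^ 2 := by gcongr
              have h2 : (Real.log v + 2 * Real.log n) * n ≤ 3 * A * n :=
                mul_le_mul_of_nonneg_right (by linarith) hn0.le
              linarith
          _ = 1 / (v * (n : ℝ) ^ 2) := by
              rw [Real.exp_neg, Real.exp_add, Real.exp_log hv0, two_mul, Real.exp_add,
                Real.exp_log hn0, one_div, sq]
      have hpow : (n : ℝ) ^ ((3 : ℝ) / 4) ≤ n := by
        simpa using Real.rpow_le_rpow_of_exponent_le (by linarith : (1 : ℝ) ≤ n)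
          (by norm_num : (3 : ℝ) / 4 ≤ 1)
      calc convPow μ n g * wordLength S g
          ≤ (K₁ * n * (1 / (v * (n : ℝ) ^ 2))) * n := by
            refine mul_le_mul ((hGauss g n (by omega)).trans ?_) hgn (by positivity) (by positivity)
            gcongr
        _ = K₁ / v := by field_simp
        _ ≤ convPow μ n g * r + K₁ / v := le_add_of_nonneg_left (by positivity)
  calc driftMeas S μ n = ∑ g ∈ B, convPow μ n g * wordLength S g :=
        tsum_eq_sum fun g hg => by
          have : convPow μ n g = 0 := by
            by_contra h
            exact hg ((hball n).mem_toFinset.2 (hsub n h))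
          rw [this, zero_mul]
    _ ≤ ∑ g ∈ B, (convPow μ n g * r + K₁ / v) := Finset.sum_le_sum hpoint
    _ = (∑ g ∈ B, convPow μ n g) * r + K₁ := by
        rw [Finset.sum_add_distrib, ← Finset.sum_mul, Finset.sum_const, hcard, nsmul_eq_mul,
          mul_div_cancel₀ _ hv0.ne']
    _ ≤ 1 * r + K₁ * √(n * A) := by
        refine add_le_add (mul_le_mul_of_nonneg_right ?_ hr0) (le_mul_of_one_le_right hK₁.le hT)
        exact sum_convPow_le_one hμ_nonneg hμ_total n (fun m => (hball m).subset (hsub m)) B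
    _ = (√(3 / K₂) + K₁) * √(n * A) := by rw [hr]; ring
end
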